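/- Equicontinuity estimate: Let 0 < κ < μ < 1, ω > 0, w_a ∈ ℝ, L > 0, and let f : [a,b] → ℝ be measurable with |f(ρ)| ≤ L for all ρ ∈ [a,b]. Define w(ℓ) = w_a + ∫_a^ℓ Φ'(ρ)(Φ(ℓ)−Φ(ρ))^{μ−1} E_{μ−κ,μ}(−ω(Φ(ℓ)−Φ(ρ))^{μ−κ}) f(ρ) dρ. Then for all a ≤ ℓ₁ ≤ ℓ₂ ≤ b, |w(ℓ₂) − w(ℓ₁)| ≤ (2L/Γ(μ+1)) (Φ(ℓ₂)−Φ(ℓ₁))^μ. -/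

import Mathlib

open Real MeasureTheory Set

/-- Two-parameter Mittag-Leffler function `E_{p,q}(x) = ∑_{k=0}^∞ x^k / Γ(pk+q)`. -/
noncomputable def mittagLeffler (p q x : ℝ) : ℝ :=
  ∑' k : ℕ, x ^ k / Real.Gamma (p * k + q)

theorem rpow_mul_exp_neg_le_Gamma {s M : ℝ} (hs : 0 ≤ s) (hM : 0 ≤ M) :
    M ^ s * Real.exp (-M) ≤ Real.Gamma (s + 1) := by
  rw [Real.Gamma_eq_integral (by linarith)]
  have hInt := Real.GammaIntegral_convergent (s := s + 1) (by linarith)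
  calc M ^ s * Real.exp (-M) = ∫ x in Ioi M, Real.exp (-x) * M ^ s := by
        rw [integral_mul_const, integral_exp_neg_Ioi, mul_comm]
    _ ≤ ∫ x in Ioi M, Real.exp (-x) * x ^ (s + 1 - 1) := by
        refine setIntegral_mono_on ((integrableOn_exp_neg_Ioi M).mul_const _)
          (hInt.mono_set (Ioi_subset_Ioi hM)) measurableSet_Ioi fun x hx => ?_
        have hx' : M < x := hx
        rw [add_sub_cancel_right]
        gcongr
    _ ≤ ∫ x in Ioi 0, Real.exp (-x) * x ^ (s + 1 - 1) := by
        refine setIntegral_mono_set hInt ?_ (Ioi_subset_Ioi hM).eventuallyLE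
        refine (ae_restrict_mem measurableSet_Ioi).mono fun x hx => ?_
        have hx' : (0 : ℝ) < x := hx
        simp only [Pi.zero_apply]
        positivity

/-- The sequence `Γ(p n + q)` grows faster than any geometric sequence. -/
theorem exists_pow_div_Gamma_le {p q : ℝ} (hp : 0 < p) (hq : 0 < q) {B : ℝ} (hB : 0 < B) :
    ∃ C : ℝ, 0 ≤ C ∧ ∀ n : ℕ, B ^ n / Real.Gamma (p * n + q) ≤ C := by
  set M : ℝ := (2 * B) ^ (1 / p) with hMdef
  have hM : 0 < M := by positivity
  have hMp : M ^ p = 2 * B := by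
    rw [hMdef, ← Real.rpow_mul (by positivity), one_div_mul_cancel hp.ne', Real.rpow_one]
  refine ⟨(p + q) * Real.exp M / M ^ q, by positivity, fun n => ?_⟩
  have hs : 0 < p * n + q := by positivity
  have hΓ : 0 < Real.Gamma (p * n + q) := Real.Gamma_pos_of_pos hs
  have h1 := rpow_mul_exp_neg_le_Gamma hs.le hM.le
  rw [Real.Gamma_add_one hs.ne', Real.rpow_add hM, Real.rpow_mul hM.le, hMp, Real.rpow_natCast,
    mul_pow, Real.exp_neg] at h1
  have h2 : p * n + q ≤ (p + q) * 2 ^ n := by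
    have h3 : (n : ℝ) ≤ 2 ^ n := by exact_mod_cast (Nat.lt_two_pow_self (n := n)).le
    have h4 : (1 : ℝ) ≤ 2 ^ n := one_le_pow₀ (by norm_num)
    nlinarith
  rw [div_le_div_iff₀ hΓ (by positivity)]
  have h5 : 2 ^ n * B ^ n * M ^ q * (Real.exp M)⁻¹
      ≤ (p + q) * 2 ^ n * Real.Gamma (p * n + q) := h1.trans (by gcongr)
  have h6 : 2 ^ n * B ^ n * M ^ q ≤ (p + q) * 2 ^ n * Real.Gamma (p * n + q) * Real.exp M := by
    rwa [← div_eq_mul_inv, div_le_iff₀ (Real.exp_pos M)] at h5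
  have h7 : (0 : ℝ) < 2 ^ n := by positivity
  refine le_of_mul_le_mul_left ?_ h7
  linarith

theorem summable_prod_pow_div_Gamma {p q : ℝ} (hp : 0 < p) (hq : 0 < q) (x y : ℝ) :
    Summable fun z : ℕ × ℕ => x ^ z.1 * y ^ z.2 / Real.Gamma (p * (z.1 + z.2 : ℕ) + q) := by
  set A : ℝ := |x| + |y| + 1 with hA
  have hA0 : 0 < A := by positivity
  obtain ⟨C, hC0, hC⟩ := exists_pow_div_Gamma_le hp hq (B := 2 * A) (by positivity)
  have hgeo : Summable fun n : ℕ => ((1 : ℝ) / 2) ^ n := summable_geometric_two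
  refine Summable.of_norm_bounded
    ((hgeo.mul_of_nonneg hgeo (fun _ => by positivity) fun _ => by positivity).mul_left C)
    fun z => ?_
  have hΓ : 0 < Real.Gamma (p * (z.1 + z.2 : ℕ) + q) := Real.Gamma_pos_of_pos (by positivity)
  rw [norm_div, norm_mul, norm_pow, norm_pow, Real.norm_of_nonneg hΓ.le, Real.norm_eq_abs,
    Real.norm_eq_abs]
  have hx : |x| ≤ A := by rw [hA]; linarith [abs_nonneg y]
  have hy : |y| ≤ A := by rw [hA]; linarith [abs_nonneg x]
  calc |x| ^ z.1 * |y| ^ z.2 / Real.Gamma (p * (z.1 + z.2 : ℕ) + q)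
      ≤ A ^ z.1 * A ^ z.2 / Real.Gamma (p * (z.1 + z.2 : ℕ) + q) := by gcongr
    _ = (2 * A) ^ (z.1 + z.2) / Real.Gamma (p * (z.1 + z.2 : ℕ) + q)
          * ((1 / 2) ^ z.1 * (1 / 2) ^ z.2) := by
        rw [← pow_add, ← pow_add, mul_pow, one_div, inv_pow]
        field_simp
    _ ≤ C * ((1 / 2) ^ z.1 * (1 / 2) ^ z.2) := by
        gcongr
        exact hC _

theorem summable_pow_div_Gamma {p q : ℝ} (hp : 0 < p) (hq : 0 < q) (x : ℝ) :
    Summable fun n : ℕ => x ^ n / Real.Gamma (p * n + q) := by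
  have h := (summable_prod_pow_div_Gamma hp hq x 0).comp_injective
    (i := fun n : ℕ => (n, 0)) (fun m n h => by simpa using h)
  simpa [Function.comp_def] using h

theorem mittagLeffler_zero (p q : ℝ) : mittagLeffler p q 0 = 1 / Real.Gamma q := by
  rw [mittagLeffler, tsum_eq_single 0 (fun n hn => by simp [hn])]
  simp

theorem continuous_mittagLeffler {p q : ℝ} (hp : 0 < p) (hq : 0 < q) :
    Continuous (mittagLeffler p q) := by
  rw [continuous_iff_continuousAt]
  intro x
  set R : ℝ := |x| + 1 with hR
  have hcont : ContinuousOn (mittagLeffler p q) (Metric.ball 0 R) := by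
    refine continuousOn_tsum (u := fun n : ℕ => R ^ n / Real.Gamma (p * n + q))
      (fun n => by fun_prop) (summable_pow_div_Gamma hp hq R) fun n y hy => ?_
    have hΓ : 0 < Real.Gamma (p * n + q) := Real.Gamma_pos_of_pos (by positivity)
    rw [norm_div, norm_pow, Real.norm_of_nonneg hΓ.le]
    gcongr
    simpa using (mem_ball_zero_iff.mp hy).le
  exact hcont.continuousAt (Metric.isOpen_ball.mem_nhds (by simp [hR]))

/-- Euler's beta integral on `[0, t]`. -/
theorem integral_sub_rpow_mul_rpow {α β t : ℝ} (hα : 0 < α) (hβ : 0 < β) (ht : 0 < t) :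
    ∫ s in (0 : ℝ)..t, (t - s) ^ (α - 1) * s ^ (β - 1)
      = Real.Gamma α * Real.Gamma β / Real.Gamma (α + β) * t ^ (α + β - 1) := by
  have h := Complex.betaIntegral_scaled β α ht
  rw [Complex.betaIntegral_eq_Gamma_mul_div _ _ (by simpa) (by simpa)] at h
  have h2 : ∫ s in (0 : ℝ)..t, (s : ℂ) ^ ((β : ℂ) - 1) * ((t : ℂ) - s) ^ ((α : ℂ) - 1)
      = ((∫ s in (0 : ℝ)..t, (t - s) ^ (α - 1) * s ^ (β - 1) : ℝ) : ℂ) := by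
    rw [← intervalIntegral.integral_ofReal]
    refine intervalIntegral.integral_congr fun s hs => ?_
    rw [uIcc_of_le ht.le] at hs
    have h3 : 0 ≤ t - s := sub_nonneg.mpr hs.2
    push_cast [Complex.ofReal_cpow h3, Complex.ofReal_cpow hs.1]
    ring
  rw [h2, Complex.Gamma_ofReal, Complex.Gamma_ofReal, ← Complex.ofReal_add, Complex.Gamma_ofReal,
    ← Complex.ofReal_one, ← Complex.ofReal_sub, ← Complex.ofReal_cpow ht.le] at h
  norm_cast at h
  rw [h, add_comm β α]
  ring

theorem intervalIntegrable_sub_rpow_mul_rpow {α β t : ℝ} (hα : 0 < α) (hβ : 0 < β) (ht : 0 < t) :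
    IntervalIntegrable (fun s => (t - s) ^ (α - 1) * s ^ (β - 1)) volume 0 t := by
  by_contra hn
  have h := integral_sub_rpow_mul_rpow hα hβ ht
  rw [intervalIntegral.integral_undef hn] at h
  have h1 := Real.Gamma_pos_of_pos hα
  have h2 := Real.Gamma_pos_of_pos hβ
  have h3 := Real.Gamma_pos_of_pos (add_pos hα hβ)
  have h4 : 0 < t ^ (α + β - 1) := Real.rpow_pos_of_pos ht _
  have : 0 < Real.Gamma α * Real.Gamma β / Real.Gamma (α + β) * t ^ (α + β - 1) := by positivity
  linarith

theorem sub_mul_tsum_prod_pow_div_Gamma {p q : ℝ} (hp : 0 < p) (hq : 0 < q) (x y : ℝ) :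
    (x - y) * ∑' z : ℕ × ℕ, x ^ z.1 * y ^ z.2 / Real.Gamma (p * (z.1 + z.2 : ℕ) + (p + q))
      = mittagLeffler p q x - mittagLeffler p q y := by
  have hsum := summable_prod_pow_div_Gamma hp (add_pos hp hq) x y
  have key : ∀ n : ℕ, (x - y) * ∑' c : Finset.HasAntidiagonal.antidiagonal n,
      x ^ (c : ℕ × ℕ).1 * y ^ (c : ℕ × ℕ).2
        / Real.Gamma (p * ((c : ℕ × ℕ).1 + (c : ℕ × ℕ).2 : ℕ) + (p + q))
      = x ^ (n + 1) / Real.Gamma (p * (n + 1 : ℕ) + q)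
        - y ^ (n + 1) / Real.Gamma (p * (n + 1 : ℕ) + q) := by
    intro n
    rw [Finset.tsum_subtype (Finset.HasAntidiagonal.antidiagonal n) fun c : ℕ × ℕ =>
      x ^ c.1 * y ^ c.2 / Real.Gamma (p * (c.1 + c.2 : ℕ) + (p + q))]
    have h1 : ∀ c ∈ Finset.HasAntidiagonal.antidiagonal n,
        x ^ c.1 * y ^ c.2 / Real.Gamma (p * (c.1 + c.2 : ℕ) + (p + q))
          = x ^ c.1 * y ^ c.2 / Real.Gamma (p * (n + 1 : ℕ) + q) := by
      intro c hc
      rw [Finset.HasAntidiagonal.mem_antidiagonal.mp hc]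
      push_cast
      ring_nf
    rw [Finset.sum_congr rfl h1, ← Finset.sum_div,
      Finset.Nat.sum_antidiagonal_eq_sum_range_succ (fun i j => x ^ i * y ^ j) n, ← sub_div,
      ← geom_sum₂_mul x y (n + 1), add_tsub_cancel_right]
    ring
  have hsum' := Finset.HasAntidiagonal.sigmaAntidiagonalEquivProd.summable_iff.mpr hsum
  have htsum : ∑' z : ℕ × ℕ, x ^ z.1 * y ^ z.2 / Real.Gamma (p * (z.1 + z.2 : ℕ) + (p + q))
      = ∑' n : ℕ, ∑' c : Finset.HasAntidiagonal.antidiagonal n,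
        x ^ (c : ℕ × ℕ).1 * y ^ (c : ℕ × ℕ).2
          / Real.Gamma (p * ((c : ℕ × ℕ).1 + (c : ℕ × ℕ).2 : ℕ) + (p + q)) :=
    (Finset.HasAntidiagonal.sigmaAntidiagonalEquivProd.tsum_eq _).symm.trans
      (hsum'.tsum_sigma' fun n => (hasSum_fintype _).summable)
  rw [htsum, ← tsum_mul_left,
    tsum_congr key, mittagLeffler, mittagLeffler,
    (summable_pow_div_Gamma hp hq x).tsum_eq_zero_add,
    (summable_pow_div_Gamma hp hq y).tsum_eq_zero_add,
    Summable.tsum_sub ((summable_nat_add_iff 1).mpr (summable_pow_div_Gamma hp hq x))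
      ((summable_nat_add_iff 1).mpr (summable_pow_div_Gamma hp hq y))]
  simp

theorem intervalIntegrable_mittagLeffler_conv {p q : ℝ} (hp : 0 < p) (hq : 0 < q) (X Y : ℝ)
    {t : ℝ} (ht : 0 < t) :
    IntervalIntegrable (fun s => ((t - s) ^ (p - 1) * s ^ (q - 1)) *
      (mittagLeffler p p (X * (t - s) ^ p) * mittagLeffler p q (Y * s ^ p))) volume 0 t := by
  refine (intervalIntegrable_sub_rpow_mul_rpow hp hq ht).mul_continuousOn (Continuous.continuousOn ?_)
  have h1 : Continuous fun s : ℝ => (t - s) ^ p :=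
    (continuous_const.sub continuous_id).rpow_const fun _ => Or.inr hp.le
  have h2 : Continuous fun s : ℝ => s ^ p := continuous_id.rpow_const fun _ => Or.inr hp.le
  exact ((continuous_mittagLeffler hp hp).comp (continuous_const.mul h1)).mul
    ((continuous_mittagLeffler hp hq).comp (continuous_const.mul h2))

/-- Convolution (resolvent) identity for the kernels `t ^ (q - 1) * E_{p,q}(X t ^ p)`. -/
theorem integral_mittagLeffler_conv {p q : ℝ} (hp : 0 < p) (hq : 0 < q) (X Y : ℝ)
    {t : ℝ} (ht : 0 < t) :
    (X - Y) * ∫ s in (0 : ℝ)..t, ((t - s) ^ (p - 1) * s ^ (q - 1)) *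
      (mittagLeffler p p (X * (t - s) ^ p) * mittagLeffler p q (Y * s ^ p))
      = t ^ (q - 1) * (mittagLeffler p q (X * t ^ p) - mittagLeffler p q (Y * t ^ p)) := by
  set c : ℕ × ℕ → ℝ := fun z =>
    (Real.Gamma (p * z.1 + p) * Real.Gamma (p * z.2 + q))⁻¹ with hc
  set k : ℕ × ℕ → ℝ → ℝ := fun z s =>
    c z * ((t - s) ^ (p * z.1 + p - 1) * s ^ (p * z.2 + q - 1)) with hk
  have hα : ∀ n : ℕ, 0 < p * n + p := fun n => by positivity
  have hβ : ∀ n : ℕ, 0 < p * n + q := fun n => by positivity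
  have hcpos : ∀ z, 0 < c z := fun z =>
    inv_pos.mpr (mul_pos (Real.Gamma_pos_of_pos (hα _)) (Real.Gamma_pos_of_pos (hβ _)))
  have hkint : ∀ z, IntegrableOn (k z) (Ioc 0 t) := fun z =>
    (intervalIntegrable_iff_integrableOn_Ioc_of_le ht.le).mp
      ((intervalIntegrable_sub_rpow_mul_rpow (hα z.1) (hβ z.2) ht).const_mul _)
  have hkval : ∀ z, ∫ s in Ioc 0 t, k z s = t ^ (p + q - 1) *
      ((t ^ p) ^ z.1 * (t ^ p) ^ z.2 / Real.Gamma (p * (z.1 + z.2 : ℕ) + (p + q))) := by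
    intro z
    rw [← intervalIntegral.integral_of_le ht.le]
    simp only [hk]
    rw [intervalIntegral.integral_const_mul, integral_sub_rpow_mul_rpow (hα _) (hβ _) ht]
    have e1 : p * z.1 + p + (p * z.2 + q) = p * (z.1 + z.2 : ℕ) + (p + q) := by
      push_cast
      ring
    have e2 : p * z.1 + p + (p * z.2 + q) - 1 = (p + q - 1) + (p * z.1 + p * z.2) := by ring
    rw [e2, e1, Real.rpow_add ht, Real.rpow_add ht, Real.rpow_mul ht.le, Real.rpow_mul ht.le,
      Real.rpow_natCast, Real.rpow_natCast]
    have := (Real.Gamma_pos_of_pos (hα z.1)).ne'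
    have := (Real.Gamma_pos_of_pos (hβ z.2)).ne'
    simp only [hc]
    field_simp
  have hknonneg : ∀ z, ∀ s ∈ Ioc 0 t, 0 ≤ k z s := fun z s hs =>
    mul_nonneg (hcpos z).le
      (mul_nonneg (Real.rpow_nonneg (sub_nonneg.mpr hs.2) _) (Real.rpow_nonneg hs.1.le _))
  have hnorm : ∀ z : ℕ × ℕ, ∫ s in Ioc 0 t, ‖X ^ z.1 * Y ^ z.2 * k z s‖ = t ^ (p + q - 1) *
      ((|X| * t ^ p) ^ z.1 * (|Y| * t ^ p) ^ z.2
        / Real.Gamma (p * (z.1 + z.2 : ℕ) + (p + q))) := by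
    intro z
    have h1 : ∫ s in Ioc 0 t, ‖X ^ z.1 * Y ^ z.2 * k z s‖
        = ∫ s in Ioc 0 t, |X| ^ z.1 * |Y| ^ z.2 * k z s := by
      refine setIntegral_congr_fun measurableSet_Ioc fun s hs => ?_
      simp only [Real.norm_eq_abs, abs_mul, abs_pow, abs_of_nonneg (hknonneg z s hs)]
    rw [h1, integral_const_mul, hkval, mul_pow, mul_pow]
    ring
  have hS := hasSum_integral_of_summable_integral_norm
    (F := fun (z : ℕ × ℕ) s => X ^ z.1 * Y ^ z.2 * k z s) (μ := volume.restrict (Ioc 0 t))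
    (fun z => (hkint z).const_mul _)
    (by
      simp only [hnorm]
      exact (summable_prod_pow_div_Gamma hp (add_pos hp hq) _ _).mul_left _)
  have hpt : ∫ s in Ioc 0 t, ∑' z : ℕ × ℕ, X ^ z.1 * Y ^ z.2 * k z s
      = ∫ s in Ioc 0 t, ((t - s) ^ (p - 1) * s ^ (q - 1)) *
      (mittagLeffler p p (X * (t - s) ^ p) * mittagLeffler p q (Y * s ^ p)) := by
    rw [integral_Ioc_eq_integral_Ioo, integral_Ioc_eq_integral_Ioo]
    refine setIntegral_congr_fun measurableSet_Ioo fun s hs => ?_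
    have hs0 : 0 < s := hs.1
    have hs1 : 0 < t - s := sub_pos.mpr hs.2
    rw [mittagLeffler, mittagLeffler,
      tsum_mul_tsum_of_summable_norm (summable_pow_div_Gamma hp hp _).norm
        (summable_pow_div_Gamma hp hq _).norm, ← tsum_mul_left]
    refine tsum_congr fun z => ?_
    have e1 : p * z.1 + p - 1 = (p - 1) + p * z.1 := by ring
    have e2 : p * z.2 + q - 1 = (q - 1) + p * z.2 := by ring
    simp only [hk, hc]
    rw [e1, e2, Real.rpow_add hs1, Real.rpow_add hs0, Real.rpow_mul hs0.le, Real.rpow_mul hs1.le,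
      Real.rpow_natCast, Real.rpow_natCast, mul_pow, mul_pow, mul_inv]
    ring
  rw [intervalIntegral.integral_of_le ht.le, ← hpt, ← hS.tsum_eq]
  simp only [integral_const_mul, hkval]
  have h2 : ∀ z : ℕ × ℕ, X ^ z.1 * Y ^ z.2 * (t ^ (p + q - 1) *
      ((t ^ p) ^ z.1 * (t ^ p) ^ z.2 / Real.Gamma (p * (z.1 + z.2 : ℕ) + (p + q))))
      = t ^ (p + q - 1) * ((X * t ^ p) ^ z.1 * (Y * t ^ p) ^ z.2
        / Real.Gamma (p * (z.1 + z.2 : ℕ) + (p + q))) := by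
    intro z
    rw [mul_pow, mul_pow]
    ring
  rw [tsum_congr h2, tsum_mul_left, ← sub_mul_tsum_prod_pow_div_Gamma hp hq]
  have e : p + q - 1 = p + (q - 1) := by ring
  rw [e, Real.rpow_add ht]
  ring

/-- Positivity of `E_{p,q}` on the negative half-line. At a first zero `t₀`, the Volterra equation
is compared with the one at a maximum point of the solution on a short interval `[η, t₀]`. -/
theorem mittagLeffler_neg_rpow_pos {p q : ℝ} (hp : 0 < p) (hp1 : p ≤ 1) (hpq : p ≤ q)
    {t : ℝ} (ht : 0 ≤ t) : 0 < mittagLeffler p q (-(t ^ p)) := by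
  have hq : 0 < q := hp.trans_le hpq
  have hΓp : 0 < Real.Gamma p := Real.Gamma_pos_of_pos hp
  have hΓq : 0 < Real.Gamma q := Real.Gamma_pos_of_pos hq
  set F : ℝ → ℝ := fun t => mittagLeffler p q (-(t ^ p)) with hF
  have hFc : Continuous F := (continuous_mittagLeffler hp hq).comp
    (continuous_id.rpow_const fun _ => Or.inr hp.le).neg
  have hvolterra : ∀ t : ℝ, 0 < t →
      IntervalIntegrable (fun s => (t - s) ^ (p - 1) * s ^ (q - 1) * F s) volume 0 t ∧
      ∫ s in (0 : ℝ)..t, (t - s) ^ (p - 1) * s ^ (q - 1) * F s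
        = Real.Gamma p * (t ^ (q - 1) * (1 / Real.Gamma q - F t)) := by
    intro t ht
    refine ⟨(intervalIntegrable_sub_rpow_mul_rpow hp hq ht).mul_continuousOn hFc.continuousOn, ?_⟩
    have h := integral_mittagLeffler_conv hp hq 0 (-1) ht
    simp only [zero_mul, neg_mul, one_mul, mittagLeffler_zero, sub_neg_eq_add, zero_add] at h
    rw [← h, ← intervalIntegral.integral_const_mul]
    refine intervalIntegral.integral_congr fun s _ => ?_
    simp only [hF]
    field_simp
  by_contra hneg
  set S : Set ℝ := {t | 0 ≤ t ∧ F t ≤ 0} with hS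
  have hSclosed : IsClosed S :=
    (isClosed_le continuous_const continuous_id).inter (isClosed_le hFc continuous_const)
  have hSne : S.Nonempty := ⟨t, ht, not_lt.mp hneg⟩
  have hSbdd : BddBelow S := ⟨0, fun x hx => hx.1⟩
  set t₀ := sInf S with ht₀
  obtain ⟨ht₀0, hFt₀⟩ : t₀ ∈ S := hSclosed.csInf_mem hSne hSbdd
  have hFpos : ∀ s, 0 ≤ s → s < t₀ → 0 < F s := fun s hs hst => by
    by_contra hn
    exact (csInf_le hSbdd ⟨hs, not_lt.mp hn⟩).not_gt hst
  have ht₀pos : 0 < t₀ := by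
    refine lt_of_le_of_ne ht₀0 fun h => ?_
    rw [← h] at hFt₀
    simp only [hF, Real.zero_rpow hp.ne', neg_zero, mittagLeffler_zero] at hFt₀
    have : 0 < 1 / Real.Gamma q := by positivity
    linarith
  set h : ℝ → ℝ := fun s => (t₀ - s) ^ (p - 1) * s ^ (q - 1) with hh
  have hInt : IntervalIntegrable h volume 0 t₀ := intervalIntegrable_sub_rpow_mul_rpow hp hq ht₀pos
  have hJ : Filter.Tendsto (fun t => ∫ s in t..t₀, h s) (nhdsWithin t₀ (Iio t₀)) (nhds 0) := by
    have hc := intervalIntegral.continuousOn_primitive_interval_left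
      ((intervalIntegrable_iff').mp hInt)
    rw [uIcc_of_le ht₀pos.le] at hc
    have h1 := hc t₀ (right_mem_Icc.mpr ht₀pos.le)
    rw [ContinuousWithinAt, intervalIntegral.integral_same] at h1
    exact h1.mono_left (nhdsWithin_le_of_mem (Icc_mem_nhdsLT ht₀pos))
  have hev : ∀ᶠ t in nhdsWithin t₀ (Iio t₀),
      (t / t₀) ^ (p - 1) * (∫ s in t..t₀, h s) < Real.Gamma p * t ^ (q - 1) := by
    have h1 : Filter.Tendsto (fun t => (t / t₀) ^ (p - 1) * (∫ s in t..t₀, h s))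
        (nhdsWithin t₀ (Iio t₀)) (nhds ((t₀ / t₀) ^ (p - 1) * 0)) := by
      refine Filter.Tendsto.mul (tendsto_nhdsWithin_of_tendsto_nhds ?_) hJ
      have : ContinuousAt (fun t : ℝ => (t / t₀) ^ (p - 1)) t₀ :=
        ContinuousAt.rpow_const (by fun_prop) (Or.inl (by positivity))
      exact this
    have h2 : Filter.Tendsto (fun t => Real.Gamma p * t ^ (q - 1))
        (nhdsWithin t₀ (Iio t₀)) (nhds (Real.Gamma p * t₀ ^ (q - 1))) := by
      refine tendsto_nhdsWithin_of_tendsto_nhds ?_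
      have : ContinuousAt (fun t : ℝ => Real.Gamma p * t ^ (q - 1)) t₀ :=
        continuousAt_const.mul (continuousAt_id.rpow_const (Or.inl ht₀pos.ne'))
      exact this
    refine h1.eventually_lt h2 ?_
    rw [mul_zero]
    positivity
  obtain ⟨l, hl, hlsub⟩ := (mem_nhdsLT_iff_exists_Ioo_subset).mp hev
  obtain ⟨η, hη1, hη2⟩ := exists_between (max_lt (show l < t₀ from hl) ht₀pos)
  have hηl : l < η := (le_max_left _ _).trans_lt hη1
  have hη0 : 0 < η := (le_max_right _ _).trans_lt hη1
  obtain ⟨u, hu, humax⟩ := isCompact_Icc.exists_isMaxOn (nonempty_Icc.mpr hη2.le)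
    hFc.continuousOn
  have humax' : ∀ s ∈ Icc η t₀, F s ≤ F u := humax
  have hFu : 0 < F u := (hFpos η hη0.le hη2).trans_le (humax' η (left_mem_Icc.mpr hη2.le))
  have hut : u < t₀ := lt_of_le_of_ne hu.2 fun h => by
    rw [h] at hFu
    exact hFu.not_ge hFt₀
  have hu0 : 0 < u := hη0.trans_le hu.1
  have hbad : (u / t₀) ^ (p - 1) * (∫ s in u..t₀, h s) < Real.Gamma p * u ^ (q - 1) :=
    hlsub ⟨hηl.trans_le hu.1, hut⟩
  obtain ⟨hi₀, he₀⟩ := hvolterra t₀ ht₀pos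
  obtain ⟨hiu, heu⟩ := hvolterra u hu0
  have hsub1 : uIcc 0 u ⊆ uIcc 0 t₀ := by
    rw [uIcc_of_le hu0.le, uIcc_of_le ht₀pos.le]
    exact Icc_subset_Icc_right hut.le
  have hsub2 : uIcc u t₀ ⊆ uIcc 0 t₀ := by
    rw [uIcc_of_le hut.le, uIcc_of_le ht₀pos.le]
    exact Icc_subset_Icc_left hu0.le
  have hsplit := intervalIntegral.integral_add_adjacent_intervals
    (hi₀.mono_set hsub1) (hi₀.mono_set hsub2)
  have htail : ∫ s in u..t₀, (t₀ - s) ^ (p - 1) * s ^ (q - 1) * F s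
      ≤ F u * ∫ s in u..t₀, h s := by
    rw [← intervalIntegral.integral_const_mul]
    refine intervalIntegral.integral_mono_on hut.le (hi₀.mono_set hsub2)
      ((hInt.mono_set hsub2).const_mul _) fun s hs => ?_
    rw [mul_comm (F u)]
    have h1 : 0 ≤ t₀ - s := sub_nonneg.mpr hs.2
    have h2 : 0 ≤ s := hu0.le.trans hs.1
    exact mul_le_mul_of_nonneg_left (humax' s ⟨hu.1.trans hs.1, hs.2⟩) (by positivity)
  have hhead : (u / t₀) ^ (p - 1) * ∫ s in (0 : ℝ)..u, (t₀ - s) ^ (p - 1) * s ^ (q - 1) * F s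
      ≤ ∫ s in (0 : ℝ)..u, (u - s) ^ (p - 1) * s ^ (q - 1) * F s := by
    rw [← intervalIntegral.integral_const_mul]
    refine intervalIntegral.integral_mono_on_of_le_Ioo hu0.le ((hi₀.mono_set hsub1).const_mul _)
      hiu fun s hs => ?_
    have h1 : 0 < u - s := sub_pos.mpr hs.2
    have h2 : 0 < t₀ - s := by linarith
    have h3 : u - s ≤ u / t₀ * (t₀ - s) := by
      rw [mul_sub, div_mul_cancel₀ _ ht₀pos.ne']
      have : u / t₀ * s ≤ 1 * s :=
        mul_le_mul_of_nonneg_right ((div_le_one ht₀pos).mpr hut.le) hs.1.le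
      linarith
    have h4 := Real.rpow_le_rpow_of_nonpos h1 h3 (show p - 1 ≤ 0 by linarith)
    rw [Real.mul_rpow (by positivity) h2.le] at h4
    have h5 := hFpos s hs.1.le (hs.2.trans hut)
    have h6 : 0 ≤ s ^ (q - 1) := Real.rpow_nonneg hs.1.le _
    calc (u / t₀) ^ (p - 1) * ((t₀ - s) ^ (p - 1) * s ^ (q - 1) * F s)
        = ((u / t₀) ^ (p - 1) * (t₀ - s) ^ (p - 1)) * (s ^ (q - 1) * F s) := by ring
      _ ≤ (u - s) ^ (p - 1) * (s ^ (q - 1) * F s) := by gcongr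
      _ = (u - s) ^ (p - 1) * s ^ (q - 1) * F s := by ring
  have hratio : u ^ (q - 1) ≤ (u / t₀) ^ (p - 1) * t₀ ^ (q - 1) := by
    have h1 : (u / t₀) ^ (q - 1) ≤ (u / t₀) ^ (p - 1) :=
      Real.rpow_le_rpow_of_exponent_ge (by positivity) ((div_le_one ht₀pos).mpr hut.le)
        (by linarith)
    rw [Real.div_rpow hu0.le ht₀pos.le (q - 1), div_le_iff₀ (by positivity)] at h1
    exact h1
  set r := (u / t₀) ^ (p - 1) with hr
  have hr0 : 0 < r := by positivity
  have hge : Real.Gamma p * (t₀ ^ (q - 1) * (1 / Real.Gamma q)) - F u * (∫ s in u..t₀, h s)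
      ≤ ∫ s in (0 : ℝ)..u, (t₀ - s) ^ (p - 1) * s ^ (q - 1) * F s := by
    have h1 : 0 ≤ Real.Gamma p * (t₀ ^ (q - 1) * (-F t₀)) := by
      have : 0 ≤ -F t₀ := by linarith
      positivity
    have h2 : Real.Gamma p * (t₀ ^ (q - 1) * (1 / Real.Gamma q - F t₀))
      = Real.Gamma p * (t₀ ^ (q - 1) * (1 / Real.Gamma q))
        + Real.Gamma p * (t₀ ^ (q - 1) * (-F t₀)) := by ring
    linarith
  have h1 := (mul_le_mul_of_nonneg_left hge hr0.le).trans hhead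
  rw [heu] at h1
  have h2 : Real.Gamma p * (1 / Real.Gamma q) * u ^ (q - 1)
      ≤ Real.Gamma p * (1 / Real.Gamma q) * (r * t₀ ^ (q - 1)) := by gcongr
  have h3 := mul_lt_mul_of_pos_left hbad hFu
  linarith

theorem mittagLeffler_nonneg {p q : ℝ} (hp : 0 < p) (hp1 : p ≤ 1) (hpq : p ≤ q)
    {x : ℝ} (hx : x ≤ 0) : 0 ≤ mittagLeffler p q x := by
  have h := mittagLeffler_neg_rpow_pos hp hp1 hpq (Real.rpow_nonneg (neg_nonneg.mpr hx) (1 / p))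
  rw [← Real.rpow_mul (neg_nonneg.mpr hx), one_div_mul_cancel hp.ne', Real.rpow_one, neg_neg] at h
  exact h.le

theorem mittagLeffler_monotoneOn {p q : ℝ} (hp : 0 < p) (hp1 : p ≤ 1) (hpq : p ≤ q) :
    MonotoneOn (mittagLeffler p q) (Iic 0) := by
  intro y hy x hx hyx
  have hq : 0 < q := hp.trans_le hpq
  have h := integral_mittagLeffler_conv hp hq x y one_pos
  rw [Real.one_rpow, Real.one_rpow, mul_one, mul_one, one_mul] at h
  rw [← sub_nonneg, ← h]
  refine mul_nonneg (sub_nonneg.mpr hyx) (intervalIntegral.integral_nonneg zero_le_one fun s hs => ?_)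
  have h1 : 0 ≤ 1 - s := sub_nonneg.mpr hs.2
  have h2 : 0 ≤ s := hs.1
  have h3 := mittagLeffler_nonneg hp hp1 le_rfl
    (mul_nonpos_of_nonpos_of_nonneg hx (Real.rpow_nonneg h1 p))
  have h4 := mittagLeffler_nonneg hp hp1 hpq
    (mul_nonpos_of_nonpos_of_nonneg hy (Real.rpow_nonneg h2 p))
  positivity

/-- Change of variables `r = Φ ℓ - Φ ρ` for a kernel `K` that may be singular at `0`. -/
theorem integral_deriv_mul_comp_sub {Φ Φ' K : ℝ → ℝ} {x y ℓ : ℝ}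
    (hΦd : ∀ ρ ∈ Icc x ℓ, HasDerivAt Φ (Φ' ρ) ρ) (hΦ'pos : ∀ ρ ∈ Icc x ℓ, 0 < Φ' ρ)
    (hKc : ContinuousOn K (Ioi 0)) (hKi : ∀ u v, IntervalIntegrable K volume u v)
    (hK0 : ∀ r, 0 < r → 0 ≤ K r) (hxy : x ≤ y) (hyℓ : y ≤ ℓ) :
    IntervalIntegrable (fun ρ => Φ' ρ * K (Φ ℓ - Φ ρ)) volume x y ∧
    ∫ ρ in x..y, Φ' ρ * K (Φ ℓ - Φ ρ)
      = (∫ r in (0 : ℝ)..(Φ ℓ - Φ x), K r) - ∫ r in (0 : ℝ)..(Φ ℓ - Φ y), K r := by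
  have hΦc : ContinuousOn Φ (Icc x ℓ) := fun ρ hρ => (hΦd ρ hρ).continuousAt.continuousWithinAt
  have hmono : StrictMonoOn Φ (Icc x ℓ) := by
    refine strictMonoOn_of_deriv_pos (convex_Icc _ _) hΦc fun ρ hρ => ?_
    have hρ' := interior_subset hρ
    rw [(hΦd ρ hρ').deriv]
    exact hΦ'pos ρ hρ'
  set H : ℝ → ℝ := fun u => ∫ r in (0 : ℝ)..u, K r with hH
  have hHc : Continuous H := intervalIntegral.continuous_primitive hKi 0
  have hHd : ∀ u, 0 < u → HasDerivAt H (K u) u := fun u hu =>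
    intervalIntegral.integral_hasDerivAt_right (hKi 0 u)
      (hKc.stronglyMeasurableAtFilter isOpen_Ioi u hu) (hKc.continuousAt (Ioi_mem_nhds hu))
  set g : ℝ → ℝ := fun ρ => -H (Φ ℓ - Φ ρ) with hg
  have hgc : ContinuousOn g (Icc x y) :=
    (hHc.comp_continuousOn (continuousOn_const.sub (hΦc.mono (Icc_subset_Icc_right hyℓ)))).neg
  have hpos : ∀ ρ ∈ Ioo x y, 0 < Φ ℓ - Φ ρ := fun ρ hρ =>
    sub_pos.mpr (hmono ⟨hρ.1.le, hρ.2.le.trans hyℓ⟩ ⟨hxy.trans hyℓ, le_rfl⟩ (hρ.2.trans_le hyℓ))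
  have hgd : ∀ ρ ∈ Ioo x y, HasDerivAt g (Φ' ρ * K (Φ ℓ - Φ ρ)) ρ := by
    intro ρ hρ
    have h1 := ((hHd _ (hpos ρ hρ)).comp ρ
      ((hΦd ρ ⟨hρ.1.le, hρ.2.le.trans hyℓ⟩).const_sub (Φ ℓ))).neg
    exact HasDerivAt.congr_deriv (f := g) h1 (by ring)
  have hInt : IntervalIntegrable (fun ρ => Φ' ρ * K (Φ ℓ - Φ ρ)) volume x y := by
    refine (intervalIntegrable_iff_integrableOn_Ioc_of_le hxy).mpr
      (intervalIntegral.integrableOn_deriv_of_nonneg hgc hgd fun ρ hρ => ?_)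
    exact mul_nonneg (hΦ'pos ρ ⟨hρ.1.le, hρ.2.le.trans hyℓ⟩).le (hK0 _ (hpos ρ hρ))
  refine ⟨hInt, ?_⟩
  rw [intervalIntegral.integral_eq_sub_of_hasDerivAt_of_le hxy hgc hgd hInt]
  simp only [hg]
  ring

/-- Equicontinuity estimate for a general nonnegative antitone kernel `K`. -/
theorem abs_integral_kernel_sub_le {a ℓ₁ ℓ₂ L : ℝ} {Φ Φ' f K : ℝ → ℝ}
    (hΦd : ∀ ρ ∈ Icc a ℓ₂, HasDerivAt Φ (Φ' ρ) ρ) (hΦ'pos : ∀ ρ ∈ Icc a ℓ₂, 0 < Φ' ρ)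
    (hfm : Measurable f) (hfb : ∀ ρ ∈ Icc a ℓ₂, |f ρ| ≤ L)
    (hKc : ContinuousOn K (Ioi 0)) (hKi : ∀ u v, IntervalIntegrable K volume u v)
    (hK0 : ∀ r, 0 < r → 0 ≤ K r) (hKa : AntitoneOn K (Ioi 0)) (h₁ : a ≤ ℓ₁) (h₂ : ℓ₁ ≤ ℓ₂) :
    |(∫ ρ in a..ℓ₂, Φ' ρ * K (Φ ℓ₂ - Φ ρ) * f ρ) - ∫ ρ in a..ℓ₁, Φ' ρ * K (Φ ℓ₁ - Φ ρ) * f ρ|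
      ≤ 2 * L * ∫ r in (0 : ℝ)..(Φ ℓ₂ - Φ ℓ₁), K r := by
  have hsub : Icc a ℓ₁ ⊆ Icc a ℓ₂ := Icc_subset_Icc_right h₂
  have hΦc : ContinuousOn Φ (Icc a ℓ₂) := fun ρ hρ => (hΦd ρ hρ).continuousAt.continuousWithinAt
  have hmono : StrictMonoOn Φ (Icc a ℓ₂) := by
    refine strictMonoOn_of_deriv_pos (convex_Icc _ _) hΦc fun ρ hρ => ?_
    have hρ' := interior_subset hρ
    rw [(hΦd ρ hρ').deriv]
    exact hΦ'pos ρ hρ'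
  have hL : 0 ≤ L := (abs_nonneg _).trans (hfb a ⟨le_rfl, h₁.trans h₂⟩)
  obtain ⟨hi1, he1⟩ := integral_deriv_mul_comp_sub (fun ρ hρ => hΦd ρ (hsub hρ))
    (fun ρ hρ => hΦ'pos ρ (hsub hρ)) hKc hKi hK0 h₁ le_rfl
  obtain ⟨hi2, he2⟩ := integral_deriv_mul_comp_sub hΦd hΦ'pos hKc hKi hK0 h₁ h₂
  obtain ⟨hi3, he3⟩ := integral_deriv_mul_comp_sub
    (fun ρ hρ => hΦd ρ (Icc_subset_Icc_left h₁ hρ))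
    (fun ρ hρ => hΦ'pos ρ (Icc_subset_Icc_left h₁ hρ)) hKc hKi hK0 h₂ le_rfl
  have hmulf : ∀ {g : ℝ → ℝ} {x y : ℝ}, a ≤ x → x ≤ y → y ≤ ℓ₂ →
      IntervalIntegrable g volume x y →
      IntervalIntegrable (fun ρ => g ρ * f ρ) volume x y := by
    intro g x y hax hxy hy hg
    rw [intervalIntegrable_iff_integrableOn_Ioc_of_le hxy] at hg ⊢
    refine Integrable.mul_bdd (c := L) hg hfm.aestronglyMeasurable ?_
    refine (ae_restrict_mem measurableSet_Ioc).mono fun ρ hρ => ?_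
    exact hfb ρ ⟨hax.trans hρ.1.le, hρ.2.trans hy⟩
  have hif1 := hmulf le_rfl h₁ h₂ hi1
  have hif2 := hmulf le_rfl h₁ h₂ hi2
  have hif3 := hmulf h₁ h₂ le_rfl hi3
  have hsplit : (∫ ρ in a..ℓ₂, Φ' ρ * K (Φ ℓ₂ - Φ ρ) * f ρ)
      - ∫ ρ in a..ℓ₁, Φ' ρ * K (Φ ℓ₁ - Φ ρ) * f ρ
      = (∫ ρ in a..ℓ₁, (Φ' ρ * K (Φ ℓ₂ - Φ ρ) * f ρ - Φ' ρ * K (Φ ℓ₁ - Φ ρ) * f ρ))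
        + ∫ ρ in ℓ₁..ℓ₂, Φ' ρ * K (Φ ℓ₂ - Φ ρ) * f ρ := by
    rw [intervalIntegral.integral_sub hif2 hif1,
      ← intervalIntegral.integral_add_adjacent_intervals hif2 hif3]
    ring
  have hne : ∀ c : ℝ, ∀ᵐ ρ : ℝ, ρ ≠ c := fun c => Measure.ae_ne volume c
  have hb1 : |∫ ρ in a..ℓ₁, (Φ' ρ * K (Φ ℓ₂ - Φ ρ) * f ρ - Φ' ρ * K (Φ ℓ₁ - Φ ρ) * f ρ)|
      ≤ ∫ ρ in a..ℓ₁, L * (Φ' ρ * K (Φ ℓ₁ - Φ ρ) - Φ' ρ * K (Φ ℓ₂ - Φ ρ)) := by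
    rw [← Real.norm_eq_abs]
    refine intervalIntegral.norm_integral_le_of_norm_le h₁ ?_ ((hi1.sub hi2).const_mul L)
    filter_upwards [hne ℓ₁] with ρ hρne hρ
    have hρ1 : ρ < ℓ₁ := lt_of_le_of_ne hρ.2 hρne
    have hmem : ρ ∈ Icc a ℓ₂ := ⟨hρ.1.le, hρ.2.trans h₂⟩
    have hp1 : 0 < Φ ℓ₁ - Φ ρ := sub_pos.mpr (hmono hmem ⟨h₁, h₂⟩ hρ1)
    have hle : Φ ℓ₁ ≤ Φ ℓ₂ := hmono.monotoneOn ⟨h₁, h₂⟩ ⟨h₁.trans h₂, le_rfl⟩ h₂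
    have hp2 : Φ ℓ₁ - Φ ρ ≤ Φ ℓ₂ - Φ ρ := by linarith
    have hK := hKa hp1 (hp1.trans_le hp2) hp2
    have hnn : 0 ≤ Φ' ρ * K (Φ ℓ₁ - Φ ρ) - Φ' ρ * K (Φ ℓ₂ - Φ ρ) :=
      sub_nonneg.mpr (mul_le_mul_of_nonneg_left hK (hΦ'pos ρ hmem).le)
    rw [← sub_mul, Real.norm_eq_abs, abs_mul, abs_sub_comm, abs_of_nonneg hnn, mul_comm]
    exact mul_le_mul_of_nonneg_right (hfb ρ hmem) hnn
  have hb2 : |∫ ρ in ℓ₁..ℓ₂, Φ' ρ * K (Φ ℓ₂ - Φ ρ) * f ρ|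
      ≤ ∫ ρ in ℓ₁..ℓ₂, L * (Φ' ρ * K (Φ ℓ₂ - Φ ρ)) := by
    rw [← Real.norm_eq_abs]
    refine intervalIntegral.norm_integral_le_of_norm_le h₂ ?_ (hi3.const_mul L)
    filter_upwards [hne ℓ₂] with ρ hρne hρ
    have hρ1 : ρ < ℓ₂ := lt_of_le_of_ne hρ.2 hρne
    have hmem : ρ ∈ Icc a ℓ₂ := ⟨h₁.trans hρ.1.le, hρ.2⟩
    have hp1 : 0 < Φ ℓ₂ - Φ ρ := sub_pos.mpr (hmono hmem ⟨h₁.trans h₂, le_rfl⟩ hρ1)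
    have hnn : 0 ≤ Φ' ρ * K (Φ ℓ₂ - Φ ρ) := mul_nonneg (hΦ'pos ρ hmem).le (hK0 _ hp1)
    rw [Real.norm_eq_abs, abs_mul, abs_of_nonneg hnn, mul_comm]
    exact mul_le_mul_of_nonneg_right (hfb ρ hmem) hnn
  have hgrow : ∫ r in (0 : ℝ)..(Φ ℓ₁ - Φ a), K r ≤ ∫ r in (0 : ℝ)..(Φ ℓ₂ - Φ a), K r := by
    have hle1 : Φ a ≤ Φ ℓ₁ := hmono.monotoneOn ⟨le_rfl, h₁.trans h₂⟩ ⟨h₁, h₂⟩ h₁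
    have hle2 : Φ ℓ₁ ≤ Φ ℓ₂ := hmono.monotoneOn ⟨h₁, h₂⟩ ⟨h₁.trans h₂, le_rfl⟩ h₂
    rw [← intervalIntegral.integral_add_adjacent_intervals (hKi 0 (Φ ℓ₁ - Φ a))
        (hKi _ (Φ ℓ₂ - Φ a)),
      le_add_iff_nonneg_right]
    rw [intervalIntegral.integral_of_le (by linarith)]
    refine setIntegral_nonneg measurableSet_Ioc fun r hr => hK0 r ?_
    linarith [hr.1]
  rw [intervalIntegral.integral_const_mul, intervalIntegral.integral_sub hi1 hi2, he1, he2] at hb1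
  rw [intervalIntegral.integral_const_mul, he3] at hb2
  simp only [sub_self, intervalIntegral.integral_same, sub_zero] at hb1 hb2
  rw [hsplit]
  refine (abs_add_le _ _).trans ((add_le_add hb1 hb2).trans ?_)
  have := mul_le_mul_of_nonneg_left hgrow hL
  linarith

/-- Equicontinuity estimate: for
`w(ℓ) = w_a + ∫_a^ℓ Φ'(ρ)(Φ(ℓ)−Φ(ρ))^{μ−1} E_{μ−κ,μ}(−ω(Φ(ℓ)−Φ(ρ))^{μ−κ}) f(ρ) dρ`
with `|f| ≤ L`, one has
`|w(ℓ₂) − w(ℓ₁)| ≤ (2L/Γ(μ+1))(Φ(ℓ₂)−Φ(ℓ₁))^μ` for `a ≤ ℓ₁ ≤ ℓ₂ ≤ b`. -/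
theorem equicontinuity_estimate
    (a b : ℝ) (hab : a < b)
    (Φ Φ' : ℝ → ℝ)
    (hΦd : ∀ x ∈ Icc a b, HasDerivAt Φ (Φ' x) x)
    (hΦ'c : ContinuousOn Φ' (Icc a b))
    (hΦ'pos : ∀ x ∈ Icc a b, 0 < Φ' x)
    (μ κ ω wa : ℝ) (hκ0 : 0 < κ) (hκμ : κ < μ) (hμ1 : μ < 1) (hω : 0 < ω)
    (L : ℝ) (hL : 0 < L)
    (f : ℝ → ℝ) (hfm : Measurable f)
    (hfb : ∀ ρ ∈ Icc a b, |f ρ| ≤ L)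
    (w : ℝ → ℝ)
    (hw : ∀ ℓ ∈ Icc a b,
      w ℓ = wa + ∫ ρ in a..ℓ,
        Φ' ρ * (Φ ℓ - Φ ρ) ^ (μ - 1) *
          mittagLeffler (μ - κ) μ (-ω * (Φ ℓ - Φ ρ) ^ (μ - κ)) * f ρ) :
    ∀ ℓ₁ ℓ₂ : ℝ, a ≤ ℓ₁ → ℓ₁ ≤ ℓ₂ → ℓ₂ ≤ b →
      |w ℓ₂ - w ℓ₁| ≤ (2 * L / Real.Gamma (μ + 1)) * (Φ ℓ₂ - Φ ℓ₁) ^ μ := by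
  intro ℓ₁ ℓ₂ h₁ h₂ h₃
  have hμ0 : 0 < μ := hκ0.trans hκμ
  have hp0 : 0 < μ - κ := sub_pos.mpr hκμ
  have hp1 : μ - κ ≤ 1 := by linarith
  have hpμ : μ - κ ≤ μ := by linarith
  have hΓ : 0 < Real.Gamma μ := Real.Gamma_pos_of_pos hμ0
  set K : ℝ → ℝ := fun r => r ^ (μ - 1) * mittagLeffler (μ - κ) μ (-ω * r ^ (μ - κ)) with hK
  have hEc : Continuous fun r : ℝ => mittagLeffler (μ - κ) μ (-ω * r ^ (μ - κ)) :=
    (continuous_mittagLeffler hp0 hμ0).comp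
      (continuous_const.mul (continuous_id.rpow_const fun _ => Or.inr hp0.le))
  have harg : ∀ r : ℝ, 0 ≤ r → -ω * r ^ (μ - κ) ≤ 0 := fun r hr =>
    mul_nonpos_of_nonpos_of_nonneg (by linarith) (Real.rpow_nonneg hr _)
  have hE0 : ∀ r : ℝ, 0 ≤ r → 0 ≤ mittagLeffler (μ - κ) μ (-ω * r ^ (μ - κ)) := fun r hr =>
    mittagLeffler_nonneg hp0 hp1 hpμ (harg r hr)
  have hKc : ContinuousOn K (Ioi 0) := fun r hr =>
    ((Real.continuousAt_rpow_const r (μ - 1) (Or.inl (ne_of_gt hr))).mul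
      hEc.continuousAt).continuousWithinAt
  have hKi : ∀ u v, IntervalIntegrable K volume u v := fun u v =>
    (intervalIntegral.intervalIntegrable_rpow' (by linarith)).mul_continuousOn hEc.continuousOn
  have hK0 : ∀ r, 0 < r → 0 ≤ K r := fun r hr =>
    mul_nonneg (Real.rpow_nonneg hr.le _) (hE0 r hr.le)
  have hKa : AntitoneOn K (Ioi 0) := by
    intro r hr s hs hrs
    have hr0 : 0 < r := hr
    refine mul_le_mul (Real.rpow_le_rpow_of_nonpos hr0 hrs (by linarith))
      (mittagLeffler_monotoneOn hp0 hp1 hpμ (harg s (hr0.le.trans hrs)) (harg r hr0.le) ?_)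
      (hE0 s (hr0.le.trans hrs)) (Real.rpow_nonneg hr0.le _)
    rw [neg_mul, neg_mul, neg_le_neg_iff]
    gcongr
  have hδ : 0 ≤ Φ ℓ₂ - Φ ℓ₁ := by
    have hmono : MonotoneOn Φ (Icc a b) := by
      refine monotoneOn_of_deriv_nonneg (convex_Icc _ _)
        (fun ρ hρ => (hΦd ρ hρ).continuousAt.continuousWithinAt)
        (fun ρ hρ => (hΦd ρ (interior_subset hρ)).differentiableAt.differentiableWithinAt)
        fun ρ hρ => ?_
      rw [(hΦd ρ (interior_subset hρ)).deriv]
      exact (hΦ'pos ρ (interior_subset hρ)).le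
    exact sub_nonneg.mpr (hmono ⟨h₁, h₂.trans h₃⟩ ⟨h₁.trans h₂, h₃⟩ h₂)
  have hKle : ∫ r in (0 : ℝ)..(Φ ℓ₂ - Φ ℓ₁), K r
      ≤ (Φ ℓ₂ - Φ ℓ₁) ^ μ / Real.Gamma (μ + 1) := by
    calc ∫ r in (0 : ℝ)..(Φ ℓ₂ - Φ ℓ₁), K r
        ≤ ∫ r in (0 : ℝ)..(Φ ℓ₂ - Φ ℓ₁), r ^ (μ - 1) * (1 / Real.Gamma μ) := by
          refine intervalIntegral.integral_mono_on hδ (hKi _ _)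
            ((intervalIntegral.intervalIntegrable_rpow' (by linarith)).mul_const _)
            fun r hr => mul_le_mul_of_nonneg_left ?_ (Real.rpow_nonneg hr.1 _)
          rw [← mittagLeffler_zero (μ - κ) μ]
          exact mittagLeffler_monotoneOn hp0 hp1 hpμ (harg r hr.1) self_mem_Iic (harg r hr.1)
      _ = (Φ ℓ₂ - Φ ℓ₁) ^ μ / Real.Gamma (μ + 1) := by
          rw [intervalIntegral.integral_mul_const, integral_rpow (Or.inl (by linarith)),
            sub_add_cancel, Real.zero_rpow hμ0.ne', Real.Gamma_add_one hμ0.ne']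
          field_simp
          ring
  have hsub : Icc a ℓ₂ ⊆ Icc a b := Icc_subset_Icc_right h₃
  have hmain := abs_integral_kernel_sub_le (fun ρ hρ => hΦd ρ (hsub hρ))
    (fun ρ hρ => hΦ'pos ρ (hsub hρ)) hfm (fun ρ hρ => hfb ρ (hsub hρ)) hKc hKi hK0 hKa h₁ h₂
  have hwK : ∀ ℓ ∈ Icc a b, w ℓ = wa + ∫ ρ in a..ℓ, Φ' ρ * K (Φ ℓ - Φ ρ) * f ρ := by
    intro ℓ hℓ
    rw [hw ℓ hℓ]
    simp only [hK, mul_assoc]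
  rw [hwK ℓ₂ ⟨h₁.trans h₂, h₃⟩, hwK ℓ₁ ⟨h₁, h₂.trans h₃⟩, add_sub_add_left_eq_sub]
  calc _ ≤ 2 * L * ∫ r in (0 : ℝ)..(Φ ℓ₂ - Φ ℓ₁), K r := hmain
    _ ≤ 2 * L * ((Φ ℓ₂ - Φ ℓ₁) ^ μ / Real.Gamma (μ + 1)) := by gcongr
    _ = _ := by ring
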